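/- arXiv:2308.01462 — 6 statements merged into one kernel-verified Lean document; each statement's English description precedes it below -/
import Mathlib

section
/- Let b_1,…,b_L ∈ 𝔽^d be nonzero vectors. Then the augmented observational orbits space 𝒪(b_1,…,b_L) coincides with the set {((A−I)g + ∑_{ℓ=1}^L μ_ℓ b_ℓ, g) ∈ 𝔽^{2d} : g ∈ Z(A;b_1,…,b_L), μ_1,…,μ_L ∈ 𝔽}. In particular, dim 𝒪(b_1,…,b_L) ≤ min(d+L, 2d). -/
/- STATEMENT 0: The augmented observational orbits space 𝒪(b_1,…,b_L) coincides with
   {((A−I)g + ∑ μ_ℓ b_ℓ, g) : g ∈ Z(A;b_1,…,b_L), μ ∈ 𝔽^L}, and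
   dim 𝒪(b_1,…,b_L) ≤ min(d+L, 2d). -/

open Finset

/-- The observational orbits space `Z(A; b_1, …, b_L)`. -/
def obsOrbitSpace {𝕜 : Type*} [RCLike 𝕜] {d L : ℕ}
    (A : Module.End 𝕜 (EuclideanSpace 𝕜 (Fin d)))
    (b : Fin L → EuclideanSpace 𝕜 (Fin d)) :
    Submodule 𝕜 (EuclideanSpace 𝕜 (Fin d)) :=
  Submodule.span 𝕜 {v | ∃ (n : ℕ) (ℓ : Fin L), v = (A ^ n) (b ℓ)}

/-- `Λ_n := ∑_{j=0}^{n-1} A^j` (so `Λ_0 = 0`). -/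
def lamOp {𝕜 : Type*} [RCLike 𝕜] {d : ℕ}
    (A : Module.End 𝕜 (EuclideanSpace 𝕜 (Fin d))) (n : ℕ) :
    Module.End 𝕜 (EuclideanSpace 𝕜 (Fin d)) :=
  ∑ j ∈ range n, A ^ j

/-- The augmented observational orbits space `𝒪(b_1, …, b_L)`. -/
def augOrbitSpace {𝕜 : Type*} [RCLike 𝕜] {d L : ℕ}
    (A : Module.End 𝕜 (EuclideanSpace 𝕜 (Fin d)))
    (b : Fin L → EuclideanSpace 𝕜 (Fin d)) :
    Submodule 𝕜 (EuclideanSpace 𝕜 (Fin d) × EuclideanSpace 𝕜 (Fin d)) :=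
  Submodule.span 𝕜 {p | ∃ (n : ℕ) (ℓ : Fin L), p = ((A ^ n) (b ℓ), (lamOp A n) (b ℓ))}

theorem augOrbitSpace_eq_and_finrank_le {𝕜 : Type*} [RCLike 𝕜] {d L : ℕ}
    (A : Module.End 𝕜 (EuclideanSpace 𝕜 (Fin d)))
    (b : Fin L → EuclideanSpace 𝕜 (Fin d)) (hb : ∀ ℓ, b ℓ ≠ 0) :
    (augOrbitSpace A b : Set (EuclideanSpace 𝕜 (Fin d) × EuclideanSpace 𝕜 (Fin d))) =
      {p | ∃ g ∈ obsOrbitSpace A b, ∃ μ : Fin L → 𝕜,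
        p = ((A - 1) g + ∑ ℓ, μ ℓ • b ℓ, g)} ∧
    Module.finrank 𝕜 (augOrbitSpace A b) ≤ min (d + L) (2 * d) := by
  have hO : ∀ (n : ℕ) (ℓ : Fin L),
      ((A ^ n) (b ℓ), (lamOp A n) (b ℓ)) ∈ augOrbitSpace A b :=
    fun n ℓ => Submodule.subset_span ⟨n, ℓ, rfl⟩
  have hΛ : ∀ (n : ℕ) (ℓ : Fin L), (lamOp A n) (b ℓ) ∈ obsOrbitSpace A b := by
    intro n ℓ
    simp only [lamOp, LinearMap.sum_apply]
    exact Submodule.sum_mem _ fun j _ => Submodule.subset_span ⟨j, ℓ, rfl⟩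
  have hb0 : ∀ ℓ : Fin L, (b ℓ, 0) ∈ augOrbitSpace A b := by
    intro ℓ
    simpa [lamOp] using hO 0 ℓ
  -- the linear parametrization `(g, μ) ↦ ((A - I) g + ∑ μ_ℓ b_ℓ, g)`
  let T : (obsOrbitSpace A b × (Fin L → 𝕜)) →ₗ[𝕜]
      (EuclideanSpace 𝕜 (Fin d) × EuclideanSpace 𝕜 (Fin d)) :=
    LinearMap.coprod
      (LinearMap.prod ((A - 1) ∘ₗ (obsOrbitSpace A b).subtype) (obsOrbitSpace A b).subtype)
      (LinearMap.prod (Fintype.linearCombination 𝕜 b) 0)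
  have hT : ∀ g μ, T (g, μ) = ((A - 1) (g : EuclideanSpace 𝕜 (Fin d)) + ∑ ℓ, μ ℓ • b ℓ,
      (g : EuclideanSpace 𝕜 (Fin d))) := by
    intro g μ
    ext1 <;> simp [T, Fintype.linearCombination_apply]
  have hle : augOrbitSpace A b ≤ LinearMap.range T := by
    refine Submodule.span_le.2 ?_
    rintro _ ⟨n, ℓ, rfl⟩
    refine ⟨(⟨_, hΛ n ℓ⟩, Pi.single ℓ 1), ?_⟩
    rw [hT]
    have h1 : (A - 1) ((lamOp A n) (b ℓ)) = (A ^ n) (b ℓ) - b ℓ := by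
      have := congrArg (fun f : Module.End 𝕜 (EuclideanSpace 𝕜 (Fin d)) => f (b ℓ))
        (mul_geom_sum A n)
      simpa only [lamOp, Module.End.mul_apply, LinearMap.sub_apply (A ^ n),
        Module.End.one_apply] using this
    have h2 : ∑ k, (Pi.single ℓ (1 : 𝕜) : Fin L → 𝕜) k • b k = b ℓ := by
      simp [Pi.single_apply, ite_smul]
    simp only [h1, h2, sub_add_cancel]
  have hg : ∀ g ∈ obsOrbitSpace A b, ((A - 1) g, g) ∈ augOrbitSpace A b := by
    intro g hg
    have : obsOrbitSpace A b ≤ (augOrbitSpace A b).comap (LinearMap.prod (A - 1) LinearMap.id) := by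
      refine Submodule.span_le.2 ?_
      rintro _ ⟨n, ℓ, rfl⟩
      have h := Submodule.sub_mem _ (hO (n + 1) ℓ) (hO n ℓ)
      have e : ((A ^ (n + 1)) (b ℓ), (lamOp A (n + 1)) (b ℓ)) -
          ((A ^ n) (b ℓ), (lamOp A n) (b ℓ)) =
          ((A - 1) ((A ^ n) (b ℓ)), (A ^ n) (b ℓ)) := by
        ext1
        · simp [pow_succ']
        · simp [lamOp, Finset.sum_range_succ]
      rw [e] at h
      exact h
    exact this hg
  have hge : LinearMap.range T ≤ augOrbitSpace A b := by
    rintro _ ⟨⟨g, μ⟩, rfl⟩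
    rw [hT]
    have h2 := Submodule.add_mem _ (hg g g.2)
      (Submodule.sum_mem _ fun ℓ (_ : ℓ ∈ Finset.univ) =>
        Submodule.smul_mem (augOrbitSpace A b) (μ ℓ) (hb0 ℓ))
    convert h2 using 1
    ext1 <;> simp [Prod.fst_sum, Prod.snd_sum]
  have heq := le_antisymm hle hge
  refine ⟨?_, le_min ?_ ?_⟩
  · ext p
    rw [SetLike.mem_coe, heq]
    constructor
    · rintro ⟨⟨g, μ⟩, rfl⟩
      exact ⟨g, g.2, μ, hT g μ⟩
    · rintro ⟨g, hg, μ, rfl⟩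
      exact ⟨(⟨g, hg⟩, μ), hT ⟨g, hg⟩ μ⟩
  · rw [heq]
    refine (LinearMap.finrank_range_le T).trans ?_
    have := Submodule.finrank_le (obsOrbitSpace A b)
    rw [Module.finrank_prod, Module.finrank_fin_fun]
    rw [finrank_euclideanSpace_fin] at this
    omega
  · refine (Submodule.finrank_le _).trans ?_
    rw [Module.finrank_prod, finrank_euclideanSpace_fin]
    omega
end

section
/- Let d ≥ 2 and let b ∈ 𝔽^d be a nonzero vector. Then dim 𝒪(b) = r + 1, where r is the degree of the minimal A-annihilating polynomial m_b of b. -/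
/- STATEMENT 1: For d ≥ 2 and b ≠ 0, dim 𝒪(b) = r + 1, where r is the degree of the
   minimal A-annihilating polynomial m_b of b. -/

open Finset Polynomial

/-- The augmented observational orbits space `𝒪(b)` (single vector). -/
def augOrbitSpace₁ {𝕜 : Type*} [RCLike 𝕜] {d : ℕ}
    (A : Module.End 𝕜 (EuclideanSpace 𝕜 (Fin d))) (b : EuclideanSpace 𝕜 (Fin d)) :
    Submodule 𝕜 (EuclideanSpace 𝕜 (Fin d) × EuclideanSpace 𝕜 (Fin d)) :=
  Submodule.span 𝕜 {p | ∃ n : ℕ, p = ((A ^ n) b, (lamOp A n) b)}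

/-- `m` is the minimal `A`-annihilating polynomial of `b`: the monic polynomial of least
degree with `m(A) b = 0`. -/
def IsMinAnnihilating {𝕜 : Type*} [RCLike 𝕜] {d : ℕ}
    (A : Module.End 𝕜 (EuclideanSpace 𝕜 (Fin d))) (b : EuclideanSpace 𝕜 (Fin d))
    (m : Polynomial 𝕜) : Prop :=
  m.Monic ∧ (aeval A m) b = 0 ∧
    ∀ p : Polynomial 𝕜, p.Monic → (aeval A p) b = 0 → m.degree ≤ p.degree

/-- The linear map `X^n ↦ ∑_{j<n} X^j`. -/
noncomputable def psiMap (𝕜 : Type*) [Field 𝕜] : 𝕜[X] →ₗ[𝕜] 𝕜[X] :=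
  Polynomial.lsum (fun n => LinearMap.toSpanSingleton 𝕜 𝕜[X] (∑ j ∈ range n, X ^ j))

lemma psiMap_monomial {𝕜 : Type*} [Field 𝕜] (n : ℕ) (a : 𝕜) :
    psiMap 𝕜 (monomial n a) = a • ∑ j ∈ range n, (X : 𝕜[X]) ^ j := by
  simp [psiMap, Polynomial.lsum_apply, Polynomial.sum_monomial_index]

lemma psiMap_mul {𝕜 : Type*} [Field 𝕜] (p : 𝕜[X]) :
    psiMap 𝕜 p * (X - 1) = p - C (p.eval 1) := by
  induction p using Polynomial.induction_on' with
  | add p q hp hq => rw [map_add, add_mul, hp, hq, eval_add, C_add]; ring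
  | monomial n a =>
    rw [psiMap_monomial, smul_mul_assoc, geom_sum_mul, ← C_mul_X_pow_eq_monomial,
      Polynomial.smul_eq_C_mul]
    simp [mul_sub]

lemma ann_iff {𝕜 : Type*} [RCLike 𝕜] {d : ℕ}
    {A : Module.End 𝕜 (EuclideanSpace 𝕜 (Fin d))}
    {b : EuclideanSpace 𝕜 (Fin d)}
    {m : Polynomial 𝕜} (hm : IsMinAnnihilating A b m) (p : 𝕜[X]) :
    (aeval A p) b = 0 ↔ m ∣ p := by
  obtain ⟨h1, h2, h3⟩ := hm
  have key : ∀ s, (aeval A (m * s)) b = 0 := by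
    intro s
    rw [mul_comm, map_mul, Module.End.mul_apply, h2, map_zero]
  constructor
  · intro hp
    rw [← Polynomial.modByMonic_eq_zero_iff_dvd h1]
    by_contra hne
    have hr : (aeval A (p %ₘ m)) b = 0 := by
      have := key (p /ₘ m)
      rw [Polynomial.modByMonic_eq_sub_mul_div, map_sub, LinearMap.sub_apply, hp, this, sub_zero]
    have hmon := Polynomial.monic_mul_leadingCoeff_inv hne
    have := h3 _ hmon (by
      rw [mul_comm, map_mul, Module.End.mul_apply, hr, map_zero])
    rw [Polynomial.degree_mul_leadingCoeff_inv _ hne] at this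
    exact absurd (Polynomial.degree_modByMonic_lt p h1) (not_lt.mpr this)
  · rintro ⟨s, rfl⟩
    exact key s

/-- The linear map `p ↦ (p(A) b, (ψ p)(A) b)`. -/
noncomputable def phiMap {𝕜 : Type*} [RCLike 𝕜] {d : ℕ}
    (A : Module.End 𝕜 (EuclideanSpace 𝕜 (Fin d))) (b : EuclideanSpace 𝕜 (Fin d)) :
    𝕜[X] →ₗ[𝕜] EuclideanSpace 𝕜 (Fin d) × EuclideanSpace 𝕜 (Fin d) :=
  let e : 𝕜[X] →ₗ[𝕜] EuclideanSpace 𝕜 (Fin d) :=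
    (LinearMap.applyₗ b).comp (aeval A).toLinearMap
  e.prod (e.comp (psiMap 𝕜))

lemma phiMap_apply {𝕜 : Type*} [RCLike 𝕜] {d : ℕ}
    (A : Module.End 𝕜 (EuclideanSpace 𝕜 (Fin d))) (b : EuclideanSpace 𝕜 (Fin d)) (p : 𝕜[X]) :
    phiMap A b p = ((aeval A p) b, (aeval A (psiMap 𝕜 p)) b) := rfl

lemma phiMap_monomial {𝕜 : Type*} [RCLike 𝕜] {d : ℕ}
    (A : Module.End 𝕜 (EuclideanSpace 𝕜 (Fin d))) (b : EuclideanSpace 𝕜 (Fin d)) (n : ℕ)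
    (a : 𝕜) :
    phiMap A b (monomial n a) = a • ((A ^ n) b, (lamOp A n) b) := by
  rw [phiMap_apply, psiMap_monomial, map_smul, map_sum, ← mul_one a, ← smul_eq_mul a,
    ← Polynomial.smul_monomial, map_smul]
  simp [lamOp, Polynomial.aeval_monomial]

lemma range_phiMap {𝕜 : Type*} [RCLike 𝕜] {d : ℕ}
    (A : Module.End 𝕜 (EuclideanSpace 𝕜 (Fin d))) (b : EuclideanSpace 𝕜 (Fin d)) :
    LinearMap.range (phiMap A b) = augOrbitSpace₁ A b := by
  apply le_antisymm
  · rintro _ ⟨p, rfl⟩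
    induction p using Polynomial.induction_on' with
    | add p q hp hq => rw [map_add]; exact add_mem hp hq
    | monomial n a =>
      rw [phiMap_monomial]
      exact Submodule.smul_mem _ _ (Submodule.subset_span ⟨n, rfl⟩)
  · refine Submodule.span_le.mpr ?_
    rintro _ ⟨n, rfl⟩
    exact ⟨monomial n 1, by rw [phiMap_monomial, one_smul]⟩

lemma ker_phiMap {𝕜 : Type*} [RCLike 𝕜] {d : ℕ}
    (A : Module.End 𝕜 (EuclideanSpace 𝕜 (Fin d))) (b : EuclideanSpace 𝕜 (Fin d)) (hb : b ≠ 0)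
    (m : Polynomial 𝕜) (hm : IsMinAnnihilating A b m) :
    LinearMap.ker (phiMap A b) =
      (Ideal.span {m * (X - 1)} : Ideal 𝕜[X]).restrictScalars 𝕜 := by
  have hX : (X - 1 : 𝕜[X]) ≠ 0 := by
    simpa using Polynomial.X_sub_C_ne_zero (1 : 𝕜)
  ext p
  rw [LinearMap.mem_ker, phiMap_apply, Prod.mk_eq_zero, ann_iff hm, ann_iff hm,
    Submodule.restrictScalars_mem, Ideal.mem_span_singleton]
  have hp := psiMap_mul p
  constructor
  · rintro ⟨h1, h2⟩
    have h3 : m ∣ C (p.eval 1) := by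
      have : C (p.eval 1) = p - psiMap 𝕜 p * (X - 1) := by rw [hp]; ring
      rw [this]
      exact dvd_sub h1 (h2.mul_right _)
    have h4 : p.eval 1 = 0 := by
      by_contra hne
      have := (ann_iff hm _).mpr h3
      rw [aeval_C, Module.algebraMap_end_apply] at this
      exact (smul_ne_zero hne hb) this
    rw [h4, C_0, sub_zero] at hp
    rw [← hp]
    exact mul_dvd_mul_right h2 _
  · rintro ⟨s, rfl⟩
    refine ⟨⟨(X - 1) * s, by ring⟩, ⟨s, mul_right_cancel₀ hX ?_⟩⟩
    rw [hp]
    simp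
    ring

theorem finrank_augOrbitSpace_eq_degree_add_one {𝕜 : Type*} [RCLike 𝕜] {d : ℕ}
    (hd : 2 ≤ d) (A : Module.End 𝕜 (EuclideanSpace 𝕜 (Fin d)))
    (b : EuclideanSpace 𝕜 (Fin d)) (hb : b ≠ 0)
    (m : Polynomial 𝕜) (hm : IsMinAnnihilating A b m) :
    Module.finrank 𝕜 (augOrbitSpace₁ A b) = m.natDegree + 1 := by
  have hX : (X - 1 : 𝕜[X]).Monic := by
    simpa using Polynomial.monic_X_sub_C (1 : 𝕜)
  have hd1 : (X - 1 : 𝕜[X]).natDegree = 1 := by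
    simpa using Polynomial.natDegree_X_sub_C (1 : 𝕜)
  rw [← range_phiMap, ← (phiMap A b).quotKerEquivRange.finrank_eq, ker_phiMap A b hb m hm]
  have := finrank_quotient_span_eq_natDegree (f := m * (X - 1))
  rw [hm.1.natDegree_mul hX, hd1] at this
  exact this
end

section
/- Let b_1,…,b_L ∈ 𝔽^d, let g ∈ Z(A;b_1,…,b_L), let μ_1,…,μ_L ∈ 𝔽, and set f := (A−I)g + ∑_{ℓ=1}^L μ_ℓ b_ℓ. Then there exists a finitely supported family (α_{n,ℓ}) of scalars in 𝔽, indexed by n ∈ ℕ∪{0} and ℓ ∈ {1,…,L}, such that f = ∑_{n,ℓ} α_{n,ℓ} A^n b_ℓ and g = ∑_{n,ℓ} α_{n,ℓ} Λ_n b_ℓ. -/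
/- STATEMENT 3: If g ∈ Z(A;b_1,…,b_L), μ_1,…,μ_L ∈ 𝔽 and f := (A−I)g + ∑ μ_ℓ b_ℓ, then
   there is a finitely supported family (α_{n,ℓ}) of scalars with
   f = ∑ α_{n,ℓ} A^n b_ℓ and g = ∑ α_{n,ℓ} Λ_n b_ℓ. -/

open Finset

theorem exists_alpha_of_characteristic_pair {𝕜 : Type*} [RCLike 𝕜] {d L : ℕ}
    (A : Module.End 𝕜 (EuclideanSpace 𝕜 (Fin d)))
    (b : Fin L → EuclideanSpace 𝕜 (Fin d))
    (g : EuclideanSpace 𝕜 (Fin d)) (hg : g ∈ obsOrbitSpace A b)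
    (μ : Fin L → 𝕜) (f : EuclideanSpace 𝕜 (Fin d))
    (hf : f = (A - 1) g + ∑ ℓ, μ ℓ • b ℓ) :
    ∃ α : (ℕ × Fin L) →₀ 𝕜,
      f = (α.sum fun p c => c • (A ^ p.1) (b p.2)) ∧
      g = (α.sum fun p c => c • (lamOp A p.1) (b p.2)) := by
  let v : ℕ × Fin L → EuclideanSpace 𝕜 (Fin d) × EuclideanSpace 𝕜 (Fin d) :=
    fun p => ((A ^ p.1) (b p.2), (lamOp A p.1) (b p.2))
  let S := Submodule.span 𝕜 (Set.range v)
  have h1 : ∀ x ∈ obsOrbitSpace A b, ((A - 1) x, x) ∈ S := by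
    intro x hx
    have hle : obsOrbitSpace A b ≤ S.comap (LinearMap.prod (A - 1) LinearMap.id) := by
      refine Submodule.span_le.2 ?_
      rintro _ ⟨n, ℓ, rfl⟩
      have e : ((A - 1) ((A ^ n) (b ℓ)), (A ^ n) (b ℓ)) = v (n + 1, ℓ) - v (n, ℓ) := by
        ext1
        · simp [v, pow_succ']
        · simp [v, lamOp, sum_range_succ]
      change ((A - 1) ((A ^ n) (b ℓ)), (A ^ n) (b ℓ)) ∈ S
      rw [e]
      exact S.sub_mem (Submodule.subset_span ⟨_, rfl⟩) (Submodule.subset_span ⟨_, rfl⟩)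
    exact hle hx
  have h2 : (∑ ℓ, μ ℓ • v (0, ℓ)) ∈ S :=
    S.sum_mem fun ℓ _ => S.smul_mem _ (Submodule.subset_span ⟨_, rfl⟩)
  have h3 : (f, g) ∈ S := by
    have e : (f, g) = ((A - 1) g, g) + ∑ ℓ, μ ℓ • v (0, ℓ) := by
      ext1
      · simp [hf, v, Prod.fst_sum]
      · simp [v, lamOp, Prod.snd_sum]
    rw [e]
    exact S.add_mem (h1 g hg) h2
  obtain ⟨α, hα⟩ := (Finsupp.mem_span_range_iff_exists_finsupp).1 h3
  refine ⟨α, ?_, ?_⟩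
  · have := congrArg Prod.fst hα
    simpa [Finsupp.sum, Prod.fst_sum, v] using this.symm
  · have := congrArg Prod.snd hα
    simpa [Finsupp.sum, Prod.snd_sum, v] using this.symm
end

section
/- Let b ∈ 𝔽^d with minimal A-annihilating polynomial m_b, and let p ∈ 𝔽[x] be a polynomial with p(A)b = 0. Then there exists a scalar a ∈ 𝔽 such that p̂(A)b = a · m̂_b(A)b. -/
/- STATEMENT 10: If m_b is the minimal A-annihilating polynomial of b and p(A)b = 0,
   then p̂(A)b = a · m̂_b(A)b for some scalar a. -/

open Polynomial

/-- `p̂(x) := (p(x) − p(1))/(x−1)`; the division is exact since `(x−1) ∣ p(x) − p(1)`. -/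
noncomputable def hatPoly {𝕜 : Type*} [RCLike 𝕜] (p : Polynomial 𝕜) : Polynomial 𝕜 :=
  (p - C (p.eval 1)) /ₘ (X - C 1)

lemma X_sub_one_mul_hatPoly {𝕜 : Type*} [RCLike 𝕜] (p : Polynomial 𝕜) :
    (X - C 1) * hatPoly p = p - C (p.eval 1) := by
  unfold hatPoly
  rw [mul_divByMonic_eq_iff_isRoot]
  simp

lemma hatPoly_mul {𝕜 : Type*} [RCLike 𝕜] (m q : Polynomial 𝕜) :
    hatPoly (m * q) = hatPoly q * m + C (q.eval 1) * hatPoly m := by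
  apply mul_left_cancel₀ (X_sub_C_ne_zero (1 : 𝕜))
  have h1 := X_sub_one_mul_hatPoly (m * q)
  have h2 := X_sub_one_mul_hatPoly m
  have h3 := X_sub_one_mul_hatPoly q
  rw [eval_mul, C_mul] at h1
  linear_combination h1 - m * h3 - C (q.eval 1) * h2

lemma IsMinAnnihilating.dvd {𝕜 : Type*} [RCLike 𝕜] {d : ℕ}
    {A : Module.End 𝕜 (EuclideanSpace 𝕜 (Fin d))} {b : EuclideanSpace 𝕜 (Fin d)}
    {m : Polynomial 𝕜} (hm : IsMinAnnihilating A b m)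
    {p : Polynomial 𝕜} (hp : (aeval A p) b = 0) : m ∣ p := by
  obtain ⟨h1, h2, h3⟩ := hm
  rw [← modByMonic_eq_zero_iff_dvd h1]
  by_contra hr
  have hr0 : (aeval A (p %ₘ m)) b = 0 := by
    have h := modByMonic_add_div p m
    rw [← h, mul_comm m] at hp
    simpa [h2] using hp
  have h4 := h3 _ (monic_mul_leadingCoeff_inv hr) (by
    rw [mul_comm]
    simp [hr0])
  rw [degree_mul_leadingCoeff_inv _ hr] at h4
  exact absurd (degree_modByMonic_lt p h1) (not_lt.mpr h4)

theorem hatPoly_apply_eq_smul {𝕜 : Type*} [RCLike 𝕜] {d : ℕ}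
    (A : Module.End 𝕜 (EuclideanSpace 𝕜 (Fin d)))
    (b : EuclideanSpace 𝕜 (Fin d)) (m : Polynomial 𝕜)
    (hm : IsMinAnnihilating A b m)
    (p : Polynomial 𝕜) (hp : (aeval A p) b = 0) :
    ∃ a : 𝕜, (aeval A (hatPoly p)) b = a • (aeval A (hatPoly m)) b := by
  obtain ⟨q, rfl⟩ := hm.dvd hp
  refine ⟨q.eval 1, ?_⟩
  rw [hatPoly_mul]
  simp [hm.2.1]
end

section
/- Let b_1,…,b_L ∈ 𝔽^d be nonzero vectors; for 1 ≤ j ≤ L let κ_j ∈ 𝔽[x] be the minimal A-conductor of b_j into V_j := Z(A;b_1,…,b_{j−1}) (with V_1 := {0}, so κ_1 = m_{b_1}), and for 2 ≤ j ≤ L let q_j^1,…,q_j^{j−1} ∈ 𝔽[x] be polynomials satisfying κ_j(A)b_j = ∑_{i=1}^{j−1} q_j^i(A)b_i. Then a vector g ∈ 𝔽^d is an A-{b_1,…,b_L} characteristic vector if and only if g = ∑_{j=1}^L a_j ( κ̂_j(A)b_j − ∑_{i=1}^{j−1} q̂_j^i(A)b_i ) for some scalars a_1,…,a_L ∈ 𝔽.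 -/
/- STATEMENT 11: With κ_j the minimal A-conductor of b_j into V_j = Z(A;b_1,…,b_{j−1})
   and polynomials q_j^i with κ_j(A)b_j = ∑_{i<j} q_j^i(A)b_i, a vector g is an
   A-{b_1,…,b_L} characteristic vector iff
   g = ∑_j a_j (κ̂_j(A)b_j − ∑_{i<j} q̂_j^i(A)b_i) for some scalars a_j. -/

open Finset Polynomial

/-- `V_j := Z(A; b_1, …, b_{j-1})` (with `V_1 = {0}`). -/
def obsOrbitSpaceBelow {𝕜 : Type*} [RCLike 𝕜] {d L : ℕ}
    (A : Module.End 𝕜 (EuclideanSpace 𝕜 (Fin d)))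
    (b : Fin L → EuclideanSpace 𝕜 (Fin d)) (j : Fin L) :
    Submodule 𝕜 (EuclideanSpace 𝕜 (Fin d)) :=
  Submodule.span 𝕜 {v | ∃ (n : ℕ) (i : Fin L), i < j ∧ v = (A ^ n) (b i)}

/-- `κ` is the minimal `A`-conductor of `b` into `V`: the monic generator of the ideal
`{p : p(A) b ∈ V}`. -/
def IsMinConductor {𝕜 : Type*} [RCLike 𝕜] {d : ℕ}
    (A : Module.End 𝕜 (EuclideanSpace 𝕜 (Fin d))) (b : EuclideanSpace 𝕜 (Fin d))
    (V : Submodule 𝕜 (EuclideanSpace 𝕜 (Fin d))) (κ : Polynomial 𝕜) : Prop :=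
  κ.Monic ∧ (aeval A κ) b ∈ V ∧ ∀ p : Polynomial 𝕜, (aeval A p) b ∈ V → κ ∣ p

theorem hatPoly_spec {𝕜 : Type*} [RCLike 𝕜] (p : Polynomial 𝕜) :
    (X - C 1) * hatPoly p + C (p.eval 1) = p := by
  have h : (X - C (1 : 𝕜)) * hatPoly p = p - C (p.eval 1) := by
    unfold hatPoly
    rw [mul_divByMonic_eq_iff_isRoot]
    simp
  rw [h]; ring

theorem hat_cancel {𝕜 : Type*} [RCLike 𝕜] {u v : Polynomial 𝕜} {k : 𝕜}
    (h : (X - C 1) * u = (X - C 1) * v + C k) : u = v := by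
  have hk : k = 0 := by
    have := congrArg (Polynomial.eval 1) h
    simpa using this.symm
  subst hk
  rw [map_zero, add_zero] at h
  exact mul_left_cancel₀ (X_sub_C_ne_zero 1) h

theorem hatPoly_neg' {𝕜 : Type*} [RCLike 𝕜] (p : Polynomial 𝕜) :
    hatPoly (-p) = - hatPoly p := by
  have h1 := hatPoly_spec p
  have h2 := hatPoly_spec (-p)
  apply hat_cancel (k := 0)
  simp only [eval_neg, map_neg, map_zero] at *
  linear_combination h1 + h2

theorem hatPoly_zero' {𝕜 : Type*} [RCLike 𝕜] : hatPoly (0 : Polynomial 𝕜) = 0 := by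
  simp [hatPoly]

/-- The evaluation map `r ↦ ∑ r_i(A) b_i`. -/
noncomputable def Phi {𝕜 : Type*} [RCLike 𝕜] {d L : ℕ}
    (A : Module.End 𝕜 (EuclideanSpace 𝕜 (Fin d)))
    (b : Fin L → EuclideanSpace 𝕜 (Fin d)) :
    (Fin L → Polynomial 𝕜) →ₗ[𝕜] EuclideanSpace 𝕜 (Fin d) where
  toFun r := ∑ i, (aeval A (r i)) (b i)
  map_add' r s := by simp [sum_add_distrib]
  map_smul' c r := by simp [smul_sum]

theorem Phi_apply {𝕜 : Type*} [RCLike 𝕜] {d L : ℕ}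
    (A : Module.End 𝕜 (EuclideanSpace 𝕜 (Fin d)))
    (b : Fin L → EuclideanSpace 𝕜 (Fin d)) (r : Fin L → Polynomial 𝕜) :
    Phi A b r = ∑ i, (aeval A (r i)) (b i) := rfl

theorem Phi_smul {𝕜 : Type*} [RCLike 𝕜] {d L : ℕ}
    (A : Module.End 𝕜 (EuclideanSpace 𝕜 (Fin d)))
    (b : Fin L → EuclideanSpace 𝕜 (Fin d)) (t : Polynomial 𝕜) (r : Fin L → Polynomial 𝕜) :
    Phi A b (t • r) = aeval A t (Phi A b r) := by
  simp [Phi_apply, map_sum, Module.End.mul_apply]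

theorem aeval_mem_of {𝕜 : Type*} [RCLike 𝕜] {d : ℕ}
    (A : Module.End 𝕜 (EuclideanSpace 𝕜 (Fin d))) (v : EuclideanSpace 𝕜 (Fin d))
    (V : Submodule 𝕜 (EuclideanSpace 𝕜 (Fin d))) (h : ∀ n : ℕ, (A ^ n) v ∈ V)
    (p : Polynomial 𝕜) : aeval A p v ∈ V := by
  rw [aeval_eq_sum_range, LinearMap.sum_apply]
  exact V.sum_mem fun i _ => V.smul_mem _ (h i)

/-- The basic relations. -/
noncomputable def rho {𝕜 : Type*} [RCLike 𝕜] {L : ℕ} (κ : Fin L → Polynomial 𝕜)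
    (q : Fin L → Fin L → Polynomial 𝕜) (j : Fin L) : Fin L → Polynomial 𝕜 :=
  fun i => if i = j then κ j else if i < j then - q j i else 0

theorem sum_split {L : ℕ} {M : Type*} [AddCommGroup M] (j : Fin L) (f : Fin L → M)
    (h : ∀ i, j < i → f i = 0) :
    ∑ i, f i = f j + ∑ i ∈ univ.filter (fun i => i < j), f i := by
  have hj : j ∉ univ.filter (fun i : Fin L => i < j) := by simp
  rw [← sum_insert hj]
  symm
  apply sum_subset (subset_univ _)
  intro i _ hi
  apply h
  simp only [mem_insert, mem_filter, mem_univ, true_and, not_or, not_lt] at hi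
  exact lt_of_le_of_ne hi.2 (Ne.symm hi.1)

theorem Phi_rho {𝕜 : Type*} [RCLike 𝕜] {d L : ℕ}
    (A : Module.End 𝕜 (EuclideanSpace 𝕜 (Fin d)))
    (b : Fin L → EuclideanSpace 𝕜 (Fin d)) (κ : Fin L → Polynomial 𝕜)
    (q : Fin L → Fin L → Polynomial 𝕜) (F : Polynomial 𝕜 → Polynomial 𝕜)
    (hF0 : F 0 = 0) (hFn : ∀ p, F (-p) = - F p) (j : Fin L) :
    Phi A b (fun i => F (rho κ q j i)) = aeval A (F (κ j)) (b j) -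
      ∑ i ∈ univ.filter (fun i => i < j), aeval A (F (q j i)) (b i) := by
  rw [Phi_apply, sum_split j, sub_eq_add_neg, ← sum_neg_distrib]
  · congr 1
    · simp [rho]
    · apply sum_congr rfl
      intro i hi
      have hi : i < j := by simpa using hi
      simp [rho, hi, hi.ne, hFn]
  · intro i hi
    simp [rho, hi.ne', hi.not_gt, hF0]

theorem relations {𝕜 : Type*} [RCLike 𝕜] {d L : ℕ}
    (A : Module.End 𝕜 (EuclideanSpace 𝕜 (Fin d)))
    (b : Fin L → EuclideanSpace 𝕜 (Fin d)) (κ : Fin L → Polynomial 𝕜)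
    (hκ : ∀ j, IsMinConductor A (b j) (obsOrbitSpaceBelow A b j) (κ j))
    (q : Fin L → Fin L → Polynomial 𝕜)
    (h0 : ∀ j, Phi A b (rho κ q j) = 0) (n : ℕ) :
    ∀ r : Fin L → Polynomial 𝕜, (∀ i : Fin L, n ≤ i → r i = 0) → Phi A b r = 0 →
      ∃ s : Fin L → Polynomial 𝕜, r = ∑ j, s j • rho κ q j := by
  induction n with
  | zero =>
    intro r hr _
    exact ⟨0, by funext i; simp [hr i (Nat.zero_le _)]⟩
  | succ n ih =>
    intro r hr hP
    by_cases hn : n < L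
    · let j : Fin L := ⟨n, hn⟩
      have hmem : aeval A (r j) (b j) ∈ obsOrbitSpaceBelow A b j := by
        rw [Phi_apply, sum_split j] at hP
        · rw [eq_neg_of_add_eq_zero_left hP]
          apply Submodule.neg_mem
          apply Submodule.sum_mem
          intro i hi
          apply aeval_mem_of
          intro m
          exact Submodule.subset_span ⟨m, i, by simpa using hi, rfl⟩
        · intro i hi
          rw [hr i (by exact hi)]
          simp
      obtain ⟨t, ht⟩ := (hκ j).2.2 _ hmem
      obtain ⟨s, hs⟩ := ih (r - t • rho κ q j) (by
        intro i hi
        rcases eq_or_lt_of_le hi with h | h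
        · have : i = j := Fin.ext h.symm
          subst this
          simp [rho, ht, mul_comm]
        · have h' : j < i := h
          simp [rho, hr i h, h'.ne', h'.not_gt]) (by
        rw [map_sub, Phi_smul, h0, hP]; simp)
      refine ⟨s + Pi.single j t, ?_⟩
      simp only [Pi.add_apply, add_smul, sum_add_distrib]
      rw [← hs, sum_eq_single j]
      · simp
      · intro i _ hi; simp [hi]
      · simp
    · exact ih r (fun i hi => absurd i.2 (by omega)) hP

theorem characteristic_vector_iff {𝕜 : Type*} [RCLike 𝕜] {d L : ℕ}
    (A : Module.End 𝕜 (EuclideanSpace 𝕜 (Fin d)))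
    (b : Fin L → EuclideanSpace 𝕜 (Fin d)) (hb : ∀ ℓ, b ℓ ≠ 0)
    (κ : Fin L → Polynomial 𝕜)
    (hκ : ∀ j, IsMinConductor A (b j) (obsOrbitSpaceBelow A b j) (κ j))
    (q : Fin L → Fin L → Polynomial 𝕜)
    (hq : ∀ j, (aeval A (κ j)) (b j) =
      ∑ i ∈ univ.filter (fun i => i < j), (aeval A (q j i)) (b i))
    (g : EuclideanSpace 𝕜 (Fin d)) :
    (g ∈ obsOrbitSpace A b ∧ (A - 1) g ∈ Submodule.span 𝕜 (Set.range b)) ↔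
      ∃ a : Fin L → 𝕜,
        g = ∑ j, a j • ((aeval A (hatPoly (κ j))) (b j) -
          ∑ i ∈ univ.filter (fun i => i < j), (aeval A (hatPoly (q j i))) (b i)) := by
  have h0 : ∀ j, Phi A b (rho κ q j) = 0 := by
    intro j
    have := Phi_rho A b κ q id rfl (fun _ => rfl) j
    simp only [id] at this
    rw [show rho κ q j = fun i => rho κ q j i from rfl, this, hq j, sub_self]
  have hw : ∀ j, (aeval A (hatPoly (κ j))) (b j) -
      ∑ i ∈ univ.filter (fun i => i < j), (aeval A (hatPoly (q j i))) (b i) =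
      Phi A b (fun i => hatPoly (rho κ q j i)) := fun j =>
    (Phi_rho A b κ q hatPoly hatPoly_zero' hatPoly_neg' j).symm
  simp only [hw]
  have hA : ∀ r, (A - 1) (Phi A b r) = Phi A b ((X - C (1 : 𝕜)) • r) := by
    intro r
    rw [Phi_smul]
    simp
  have hC : ∀ c : Fin L → 𝕜, Phi A b (fun i => C (c i)) = ∑ i, c i • b i := by
    intro c
    simp [Phi_apply]
  constructor
  · rintro ⟨hg, hAg⟩
    have hle : obsOrbitSpace A b ≤ LinearMap.range (Phi A b) := by
      apply Submodule.span_le.2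
      rintro _ ⟨n, l, rfl⟩
      refine ⟨Pi.single l (X ^ n), ?_⟩
      rw [Phi_apply, sum_eq_single l]
      · simp
      · intro i _ hi; simp [hi]
      · simp
    obtain ⟨p, rfl⟩ := hle hg
    obtain ⟨c, hc⟩ := (Submodule.mem_span_range_iff_exists_fun 𝕜).1 hAg
    obtain ⟨s, hs⟩ := relations A b κ hκ q h0 L
      ((X - C (1 : 𝕜)) • p - fun i => C (c i)) (fun i hi => absurd i.2 (by omega))
      (by rw [map_sub, ← hA, hC, hc, sub_self])
    refine ⟨fun j => (s j).eval 1, ?_⟩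
    have hp : p = ∑ j, (hatPoly (s j) • rho κ q j +
        (s j).eval 1 • fun i => hatPoly (rho κ q j i)) := by
      funext i
      have hi := congrFun hs i
      simp only [Pi.sub_apply, Pi.smul_apply, smul_eq_mul, Finset.sum_apply] at hi
      apply hat_cancel (k := c i + ∑ j, (s j).eval 1 * (rho κ q j i).eval 1)
      rw [sub_eq_iff_eq_add.1 hi]
      simp only [Finset.sum_apply, Pi.add_apply, Pi.smul_apply, smul_eq_mul, map_add, map_sum,
        map_mul, mul_sum, smul_eq_C_mul]
      rw [add_comm (C (c i)), ← add_assoc, ← sum_add_distrib]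
      congr 1
      apply sum_congr rfl
      intro j _
      have h1 := hatPoly_spec (s j)
      have h2 := hatPoly_spec (rho κ q j i)
      linear_combination (-(rho κ q j i)) * h1 - C ((s j).eval 1) * h2
    conv_lhs => rw [hp]
    simp only [map_sum, map_add, Phi_smul, h0, map_smul, map_zero, zero_add]
  · rintro ⟨a, rfl⟩
    constructor
    · refine Submodule.sum_mem _ fun j _ => Submodule.smul_mem _ _ ?_
      rw [Phi_apply]
      refine Submodule.sum_mem _ fun i _ => aeval_mem_of _ _ _ (fun n => ?_) _
      exact Submodule.subset_span ⟨n, i, rfl⟩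
    · rw [map_sum]
      refine Submodule.sum_mem _ fun j _ => ?_
      rw [map_smul, hA]
      apply Submodule.smul_mem
      have : (X - C (1 : 𝕜)) • (fun i => hatPoly (rho κ q j i)) =
          rho κ q j - fun i => C ((rho κ q j i).eval 1) := by
        funext i
        have := hatPoly_spec (rho κ q j i)
        simp only [Pi.smul_apply, Pi.sub_apply, smul_eq_mul]
        linear_combination this
      rw [this, map_sub, h0, hC, zero_sub]
      apply Submodule.neg_mem
      exact Submodule.sum_mem _ fun i _ => Submodule.smul_mem _ _ (Submodule.subset_span ⟨i, rfl⟩)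
end

section
/- If b_1,…,b_L ∈ 𝔽^d are linearly independent vectors, then the A-{b_1,…,b_L} characteristic space 𝒢 := {g ∈ Z(A;b_1,…,b_L) : (A − I)g ∈ span{b_1,…,b_L}} has dimension exactly L. -/
/- STATEMENT 12: If b_1,…,b_L are linearly independent, then the A-{b_1,…,b_L}
   characteristic space 𝒢 = {g ∈ Z(A;b_1,…,b_L) : (A−I)g ∈ span{b_1,…,b_L}} has
   dimension exactly L. -/

open Finset

/-- The `A`-`{b_1,…,b_L}` characteristic space
`𝒢 = {g ∈ Z(A;b_1,…,b_L) : (A − I) g ∈ span{b_1,…,b_L}}`. -/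
def charSpace {𝕜 : Type*} [RCLike 𝕜] {d L : ℕ}
    (A : Module.End 𝕜 (EuclideanSpace 𝕜 (Fin d)))
    (b : Fin L → EuclideanSpace 𝕜 (Fin d)) :
    Submodule 𝕜 (EuclideanSpace 𝕜 (Fin d)) :=
  obsOrbitSpace A b ⊓ Submodule.comap (A - 1) (Submodule.span 𝕜 (Set.range b))

theorem aux_finrank {K V : Type*} [Field K] [AddCommGroup V] [Module K V] [FiniteDimensional K V]
    (Z B : Submodule K V) (T : Module.End K V) (hB : B ≤ Z) (hT : Z.map T ≤ Z)
    (hZ : Z ≤ B ⊔ Z.map T) :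
    Module.finrank K (Z ⊓ B.comap T : Submodule K V) = Module.finrank K B := by
  have key : ∀ C : Submodule K V, Module.finrank K (C.comap Z.subtype)
      = Module.finrank K (Z ⊓ C : Submodule K V) := by
    intro C
    rw [← Submodule.map_comap_subtype]
    exact (LinearEquiv.finrank_eq (Submodule.equivMapOfInjective Z.subtype Z.injective_subtype _))
  have h1 := LinearMap.finrank_range_add_finrank_ker (B.mkQ ∘ₗ T ∘ₗ Z.subtype)
  have h2 := LinearMap.finrank_range_add_finrank_ker (B.mkQ ∘ₗ Z.subtype)
  have hr : LinearMap.range (B.mkQ ∘ₗ T ∘ₗ Z.subtype) = LinearMap.range (B.mkQ ∘ₗ Z.subtype) := by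
    rw [LinearMap.range_comp, LinearMap.range_comp, LinearMap.range_comp, Submodule.range_subtype]
    apply le_antisymm (Submodule.map_mono hT)
    refine (Submodule.map_mono hZ).trans ?_
    rw [Submodule.map_sup, Submodule.mkQ_map_self, bot_sup_eq]
  have k1 : LinearMap.ker (B.mkQ ∘ₗ T ∘ₗ Z.subtype) = (B.comap T).comap Z.subtype := by
    rw [LinearMap.ker_comp, Submodule.ker_mkQ, Submodule.comap_comp]
  have k2 : LinearMap.ker (B.mkQ ∘ₗ Z.subtype) = B.comap Z.subtype := by
    rw [LinearMap.ker_comp, Submodule.ker_mkQ]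
  rw [k1, hr, key] at h1
  rw [k2, key, inf_eq_right.mpr hB] at h2
  omega

theorem finrank_charSpace_eq {𝕜 : Type*} [RCLike 𝕜] {d L : ℕ}
    (A : Module.End 𝕜 (EuclideanSpace 𝕜 (Fin d)))
    (b : Fin L → EuclideanSpace 𝕜 (Fin d))
    (hb : LinearIndependent 𝕜 b) :
    Module.finrank 𝕜 (charSpace A b) = L := by
  have hmem : ∀ (n : ℕ) (ℓ : Fin L), (A ^ n) (b ℓ) ∈ obsOrbitSpace A b := fun n ℓ =>
    Submodule.subset_span ⟨n, ℓ, rfl⟩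
  have hsucc : ∀ (n : ℕ) (ℓ : Fin L),
      (A - 1) ((A ^ n) (b ℓ)) = (A ^ (n + 1)) (b ℓ) - (A ^ n) (b ℓ) := by
    intro n ℓ
    rw [pow_succ']
    rfl
  have hfin : Module.finrank 𝕜 (Submodule.span 𝕜 (Set.range b)) = L := by
    rw [finrank_span_eq_card hb, Fintype.card_fin]
  unfold charSpace
  rw [aux_finrank, hfin]
  · rw [Submodule.span_le]
    rintro _ ⟨ℓ, rfl⟩
    exact hmem 0 ℓ
  · rw [Submodule.map_le_iff_le_comap]
    conv_lhs => unfold obsOrbitSpace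
    rw [Submodule.span_le]
    rintro _ ⟨n, ℓ, rfl⟩
    change (A - 1) ((A ^ n) (b ℓ)) ∈ obsOrbitSpace A b
    rw [hsucc]
    exact sub_mem (hmem _ _) (hmem _ _)
  · conv_lhs => unfold obsOrbitSpace
    rw [Submodule.span_le]
    rintro _ ⟨n, ℓ, rfl⟩
    induction n with
    | zero => exact Submodule.mem_sup_left (Submodule.subset_span ⟨ℓ, rfl⟩)
    | succ n ih =>
      have h := hsucc n ℓ
      rw [eq_sub_iff_add_eq] at h
      rw [← h]
      exact add_mem (Submodule.mem_sup_right (Submodule.mem_map_of_mem (hmem n ℓ))) ih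
end
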